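/- Let α = 1/10. For τ > 0 let φ_cat(r) = τ·log(r/τ + √((r/τ)² − 1)) and let G(r) = cos r · log(2·tan(r/2)) + 1 − cos r, and define f_τ(r) = φ_cat(r) − τ·G(r) + τ·log(τ/2)·cos r on (τ, π). There exist constants C > 0 and τ₀ > 0 such that for all τ ∈ (0, τ₀), all r ∈ (τ^α, 9·τ^α), and each k ∈ {0, 1, 2}, the k-th derivative of f_τ satisfies |f_τ^{(k)}(r)| ≤ C·τ^{1+(2−k)·α}·|log τ|. -/

import Mathlib

/-- The logarithmic part of the Green's function has derivative `1 / sin`. -/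
lemma hasDerivAt_log_two_mul_tan_half {x : ℝ} (hx0 : 0 < x) (hxpi : x < Real.pi) :
    HasDerivAt (fun x : ℝ => Real.log (2 * Real.tan (x / 2))) (1 / Real.sin x) x := by
  have hc : 0 < Real.cos (x / 2) :=
    Real.cos_pos_of_mem_Ioo ⟨by linarith [Real.pi_pos], by linarith⟩
  have hs : 0 < Real.sin (x / 2) :=
    Real.sin_pos_of_pos_of_lt_pi (by linarith) (by linarith [Real.pi_pos])
  have hsin : Real.sin x = 2 * Real.sin (x / 2) * Real.cos (x / 2) := by
    rw [← Real.sin_two_mul]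
    congr 1
    ring
  have htan : Real.tan (x / 2) ≠ 0 := by
    rw [Real.tan_eq_sin_div_cos]
    positivity
  have h : HasDerivAt (fun x : ℝ => Real.tan (x / 2)) (1 / Real.cos (x / 2) ^ 2 * (1 / 2)) x :=
    HasDerivAt.comp (h₂ := Real.tan) x (Real.hasDerivAt_tan hc.ne')
      ((hasDerivAt_id' x).div_const 2)
  refine ((h.const_mul 2).log (mul_ne_zero two_ne_zero htan)).congr_deriv ?_
  rw [hsin, Real.tan_eq_sin_div_cos]
  field_simp

lemma hasDerivAt_catenoid_profile {τ x : ℝ} (hτ : 0 < τ) (hx : τ < x) :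
    HasDerivAt (fun x : ℝ => τ * Real.log (x / τ + Real.sqrt ((x / τ) ^ 2 - 1)))
      (τ * (1 / Real.sqrt (x ^ 2 - τ ^ 2))) x := by
  have h1 : x / τ ∈ Set.Ioi (1 : ℝ) := (one_lt_div hτ).2 hx
  have h := ((Real.hasDerivAt_arcosh h1).comp x ((hasDerivAt_id x).div_const τ)).const_mul τ
  have hsqrt : Real.sqrt (x ^ 2 - τ ^ 2) = τ * Real.sqrt ((x / τ) ^ 2 - 1) := by
    have : x ^ 2 - τ ^ 2 = τ ^ 2 * ((x / τ) ^ 2 - 1) := by field_simp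
    rw [this, Real.sqrt_mul (by positivity), Real.sqrt_sq hτ.le]
  refine h.congr_deriv ?_
  rw [hsqrt]
  field_simp

lemma hasDerivAt_inv_sqrt_sq_sub_sq {τ x : ℝ} (hτ : 0 < τ) (hx : τ < x) :
    HasDerivAt (fun x : ℝ => 1 / Real.sqrt (x ^ 2 - τ ^ 2))
      (-x / Real.sqrt (x ^ 2 - τ ^ 2) ^ 3) x := by
  have hpos : 0 < x ^ 2 - τ ^ 2 := by nlinarith
  have hs := Real.sqrt_pos.2 hpos
  have h : HasDerivAt (fun x : ℝ => (Real.sqrt (x ^ 2 - τ ^ 2))⁻¹) _ x :=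
    (((hasDerivAt_pow 2 x).sub_const (τ ^ 2)).sqrt hpos.ne').inv hs.ne'
  simp only [one_div]
  refine h.congr_deriv ?_
  field_simp
  norm_num

/-- The first derivative of the difference between the catenoid profile and the matched
multiple of the Green's function. -/
noncomputable def matchingErrorDeriv (τ x : ℝ) : ℝ :=
  τ * (1 / Real.sqrt (x ^ 2 - τ ^ 2)) -
    τ * (-Real.sin x * Real.log (2 * Real.tan (x / 2)) + Real.cos x / Real.sin x + Real.sin x) -
    τ * Real.log (τ / 2) * Real.sin x

/-- The second derivative of the difference between the catenoid profile and the matched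
multiple of the Green's function. -/
noncomputable def matchingErrorDeriv₂ (τ x : ℝ) : ℝ :=
  τ * (-x / Real.sqrt (x ^ 2 - τ ^ 2) ^ 3) -
    τ * (-Real.cos x * Real.log (2 * Real.tan (x / 2)) - 1 - 1 / Real.sin x ^ 2 + Real.cos x) -
    τ * Real.log (τ / 2) * Real.cos x

lemma hasDerivAt_matchingError {τ x : ℝ} (hτ : 0 < τ) (hx : τ < x) (hxpi : x < Real.pi) :
    HasDerivAt (fun x : ℝ =>
      τ * Real.log (x / τ + Real.sqrt ((x / τ) ^ 2 - 1)) -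
        τ * (Real.cos x * Real.log (2 * Real.tan (x / 2)) + 1 - Real.cos x) +
        τ * Real.log (τ / 2) * Real.cos x) (matchingErrorDeriv τ x) x := by
  have hT := hasDerivAt_log_two_mul_tan_half (hτ.trans hx) hxpi
  have hcos := Real.hasDerivAt_cos x
  have h := ((hasDerivAt_catenoid_profile hτ hx).sub
    ((((hcos.mul hT).add_const 1).sub hcos).const_mul τ)).add
    (hcos.const_mul (τ * Real.log (τ / 2)))
  refine h.congr_deriv ?_
  rw [matchingErrorDeriv]
  ring

lemma hasDerivAt_matchingErrorDeriv {τ x : ℝ} (hτ : 0 < τ) (hx : τ < x) (hxpi : x < Real.pi) :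
    HasDerivAt (matchingErrorDeriv τ) (matchingErrorDeriv₂ τ x) x := by
  have hT := hasDerivAt_log_two_mul_tan_half (hτ.trans hx) hxpi
  have hcos := Real.hasDerivAt_cos x
  have hsin := Real.hasDerivAt_sin x
  have hs : Real.sin x ≠ 0 := (Real.sin_pos_of_pos_of_lt_pi (hτ.trans hx) hxpi).ne'
  have h := (((hasDerivAt_inv_sqrt_sq_sub_sq hτ hx).const_mul τ).sub
    ((((hsin.neg.mul hT).add (hcos.div hsin hs)).add hsin).const_mul τ)).sub
    (hsin.const_mul (τ * Real.log (τ / 2)))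
  refine h.congr_deriv ?_
  rw [matchingErrorDeriv₂, Pi.neg_apply]
  field_simp
  linear_combination Real.sin_sq_add_cos_sq x

lemma tan_le_add_cube {y : ℝ} (hy0 : 0 ≤ y) (hy1 : y ≤ 1) : Real.tan y ≤ y + y ^ 3 := by
  have hcos := Real.one_sub_sq_div_two_le_cos (x := y)
  have hpos : 0 < Real.cos y := by nlinarith
  rw [Real.tan_eq_sin_div_cos, div_le_iff₀ hpos]
  have h1 : (y + y ^ 3) * (1 - y ^ 2 / 2) ≤ (y + y ^ 3) * Real.cos y := by gcongr
  have h2 : y ^ 5 ≤ y ^ 3 := pow_le_pow_of_le_one hy0 hy1 (by norm_num)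
  linarith [Real.sin_le hy0, pow_nonneg hy0 3]

/-- The factor multiplying `cos` or `sin` in the matching error is logarithmic in `τ`. -/
lemma abs_log_two_mul_tan_half_sub_log_le {τ x : ℝ} (hτ : 0 < τ) (hτ1 : 1 ≤ |Real.log τ|)
    (hτ2 : τ < 1) (hx : τ < x) (hx1 : x < 1) :
    |Real.log (2 * Real.tan (x / 2)) - Real.log (τ / 2)| ≤ 3 * |Real.log τ| := by
  have hx0 : 0 < x := hτ.trans hx
  have hlow := Real.lt_tan (x := x / 2) (by linarith) (by linarith [Real.pi_gt_three])
  have hup := tan_le_add_cube (y := x / 2) (by linarith) (by linarith)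
  have hcube : (x / 2) ^ 3 ≤ x / 2 := by
    have := pow_le_pow_of_le_one (a := x / 2) (by linarith) (by linarith) (show 1 ≤ 3 by norm_num)
    simpa using this
  have hL : |Real.log τ| = -Real.log τ := abs_of_neg (Real.log_neg hτ hτ2)
  have h2 : Real.log 2 < 1 := by linarith [Real.log_two_lt_d9]
  have h2' : 0 < Real.log 2 := Real.log_pos (by norm_num)
  have hT1 : Real.log τ ≤ Real.log (2 * Real.tan (x / 2)) := Real.log_le_log hτ (by linarith)
  have hT2 : Real.log (2 * Real.tan (x / 2)) ≤ Real.log 2 :=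
    Real.log_le_log (by linarith) (by linarith)
  rw [Real.log_div hτ.ne' two_ne_zero, abs_le]
  constructor <;> linarith

/-- Elementary bounds on `√(x² - τ²)` when `τ ≤ x²`. -/
lemma sqrt_sq_sub_sq_bounds {τ x : ℝ} (hτ : 0 < τ) (hτ2 : τ ≤ 1 / 4) (hx0 : 0 < x)
    (hx : τ ≤ x ^ 2) :
    x / 2 ≤ Real.sqrt (x ^ 2 - τ ^ 2) ∧ Real.sqrt (x ^ 2 - τ ^ 2) ≤ x ∧
      x - Real.sqrt (x ^ 2 - τ ^ 2) ≤ x ^ 3 := by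
  have h1 : x / 2 ≤ Real.sqrt (x ^ 2 - τ ^ 2) := Real.le_sqrt_of_sq_le (by nlinarith)
  have h2 : Real.sqrt (x ^ 2 - τ ^ 2) ≤ x := Real.sqrt_le_iff.2 ⟨hx0.le, by nlinarith⟩
  refine ⟨h1, h2, ?_⟩
  have hsq : Real.sqrt (x ^ 2 - τ ^ 2) ^ 2 = x ^ 2 - τ ^ 2 := Real.sq_sqrt (by nlinarith)
  set s := Real.sqrt (x ^ 2 - τ ^ 2)
  have h3 : (x - s) * x ≤ x ^ 3 * x := by
    have : (x - s) * x ≤ (x - s) * (x + s) := by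
      gcongr
      linarith
    have : τ ^ 2 ≤ (x ^ 2) ^ 2 := by gcongr
    nlinarith
  exact le_of_mul_le_mul_right h3 hx0

lemma sin_bounds {x : ℝ} (hx0 : 0 < x) (hx1 : x < 1) :
    x / 2 ≤ Real.sin x ∧ Real.sin x ≤ x ∧ x - Real.sin x ≤ x ^ 3 / 6 := by
  have h := Real.sin_ge_sub_cube hx0.le
  have hcube : x ^ 3 ≤ x := by
    simpa using pow_le_pow_of_le_one hx0.le hx1.le (show 1 ≤ 3 by norm_num)
  exact ⟨by linarith, Real.sin_le hx0.le, by linarith⟩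

lemma abs_matchingError_le {τ x : ℝ} (hτ : 0 < τ) (hτ1 : 1 ≤ |Real.log τ|) (hτ2 : τ ≤ 1 / 4)
    (hτx : τ < x) (hx1 : x < 1) (hx : τ ≤ x ^ 2) :
    |τ * Real.log (x / τ + Real.sqrt ((x / τ) ^ 2 - 1)) -
        τ * (Real.cos x * Real.log (2 * Real.tan (x / 2)) + 1 - Real.cos x) +
        τ * Real.log (τ / 2) * Real.cos x| ≤ 100 * (τ * x ^ 2 * |Real.log τ|) := by
  have hx0 : 0 < x := hτ.trans hτx
  have hD := abs_log_two_mul_tan_half_sub_log_le hτ hτ1 (by linarith) hτx hx1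
  obtain ⟨hs1, hs2, hs3⟩ := sqrt_sq_sub_sq_bounds hτ hτ2 hx0 hx
  have hlow := Real.lt_tan (x := x / 2) (by linarith) (by linarith [Real.pi_gt_three])
  have hup := tan_le_add_cube (y := x / 2) (by linarith) (by linarith)
  have hsqrt : x / τ + Real.sqrt ((x / τ) ^ 2 - 1) = (x + Real.sqrt (x ^ 2 - τ ^ 2)) / τ := by
    have : (x / τ) ^ 2 - 1 = (x ^ 2 - τ ^ 2) / τ ^ 2 := by field_simp
    rw [this, Real.sqrt_div' _ (by positivity), Real.sqrt_sq hτ.le]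
    ring
  have hcos := Real.one_sub_sq_div_two_le_cos (x := x)
  have hcos' := Real.cos_le_one x
  rw [hsqrt]
  set s := Real.sqrt (x ^ 2 - τ ^ 2)
  set t := Real.tan (x / 2)
  have ht : 0 < t := by linarith
  have hxs : 0 < x + s := by linarith
  have hlog : Real.log ((x + s) / τ) - Real.log (2 * t) + Real.log (τ / 2) =
      Real.log ((x + s) / (4 * t)) := by
    rw [← Real.log_div (by positivity) (by positivity),
      ← Real.log_mul (by positivity) (by positivity)]
    congr 1
    field_simp
    norm_num
  have hA1 : Real.log ((x + s) / (4 * t)) ≤ 0 :=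
    Real.log_nonpos (by positivity) ((div_le_one (by positivity)).2 (by linarith))
  have hA2 : -(2 * x ^ 2) ≤ Real.log ((x + s) / (4 * t)) := by
    refine le_trans ?_ (Real.one_sub_inv_le_log_of_pos (by positivity))
    rw [inv_div, neg_le_sub_iff_le_add, div_le_iff₀ hxs]
    nlinarith [pow_pos hx0 3, mul_le_mul_of_nonneg_left hs1 (sq_nonneg x)]
  have hA : |Real.log ((x + s) / (4 * t))| ≤ 2 * x ^ 2 := abs_le.2 ⟨hA2, by nlinarith⟩
  have hc : |1 - Real.cos x| ≤ x ^ 2 / 2 := abs_le.2 ⟨by nlinarith, by linarith⟩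
  have hprod : |(1 - Real.cos x) * (Real.log (2 * t) - Real.log (τ / 2))| ≤
      x ^ 2 / 2 * (3 * |Real.log τ|) := by
    rw [abs_mul]
    gcongr
  have hL : x ^ 2 ≤ x ^ 2 * |Real.log τ| := le_mul_of_one_le_right (by positivity) hτ1
  have heq : τ * Real.log ((x + s) / τ) - τ * (Real.cos x * Real.log (2 * t) + 1 - Real.cos x) +
      τ * Real.log (τ / 2) * Real.cos x =
      τ * ((1 - Real.cos x) * (Real.log (2 * t) - Real.log (τ / 2)) - (1 - Real.cos x) +
        Real.log ((x + s) / (4 * t))) := by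
    rw [← hlog]
    ring
  rw [heq, abs_mul, abs_of_pos hτ, mul_left_comm, mul_assoc τ]
  gcongr
  rw [abs_le] at hprod hc hA ⊢
  constructor <;> linarith

lemma abs_matchingErrorDeriv_le {τ x : ℝ} (hτ : 0 < τ) (hτ1 : 1 ≤ |Real.log τ|)
    (hτ2 : τ ≤ 1 / 4) (hτx : τ < x) (hx1 : x < 1) (hx : τ ≤ x ^ 2) :
    |matchingErrorDeriv τ x| ≤ 100 * (τ * x * |Real.log τ|) := by
  have hx0 : 0 < x := hτ.trans hτx
  have hD := abs_log_two_mul_tan_half_sub_log_le hτ hτ1 (by linarith) hτx hx1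
  obtain ⟨hs1, hs2, hs3⟩ := sqrt_sq_sub_sq_bounds hτ hτ2 hx0 hx
  obtain ⟨hsin1, hsin2, hsin3⟩ := sin_bounds hx0 hx1
  have hcos := Real.one_sub_sq_div_two_le_cos (x := x)
  have hcos' := Real.cos_le_one x
  rw [matchingErrorDeriv]
  set s := Real.sqrt (x ^ 2 - τ ^ 2)
  set T := Real.log (2 * Real.tan (x / 2))
  have hspos : 0 < s := by linarith
  have hsinpos : 0 < Real.sin x := by linarith
  have hA : |1 / s - 1 / x| ≤ 2 * x := by
    rw [abs_of_nonneg (sub_nonneg.2 (one_div_le_one_div_of_le hspos hs2)),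
      div_sub_div _ _ hspos.ne' hx0.ne', div_le_iff₀ (by positivity)]
    nlinarith [mul_le_mul_of_nonneg_left hs1 (sq_nonneg x)]
  have hB : |1 / x - Real.cos x / Real.sin x| ≤ x := by
    rw [div_sub_div _ _ hx0.ne' hsinpos.ne', abs_div, abs_of_pos (mul_pos hx0 hsinpos),
      div_le_iff₀ (by positivity)]
    have h1 := mul_le_mul_of_nonneg_left hcos hx0.le
    have h2 := mul_le_mul_of_nonneg_left hcos' hx0.le
    have h3 := mul_le_mul_of_nonneg_left hsin1 (sq_nonneg x)
    have h4 := pow_pos hx0 3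
    rw [abs_le]
    constructor <;> nlinarith
  have hS : |Real.sin x| ≤ x := by rwa [abs_of_pos hsinpos]
  have hprod : |Real.sin x * (T - Real.log (τ / 2))| ≤ x * (3 * |Real.log τ|) := by
    rw [abs_mul]
    gcongr
  have hL : x ≤ x * |Real.log τ| := le_mul_of_one_le_right hx0.le hτ1
  have heq : τ * (1 / s) - τ * (-Real.sin x * T + Real.cos x / Real.sin x + Real.sin x) -
      τ * Real.log (τ / 2) * Real.sin x =
      τ * (Real.sin x * (T - Real.log (τ / 2)) - Real.sin x + (1 / s - 1 / x) +
        (1 / x - Real.cos x / Real.sin x)) := by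
    ring
  rw [heq, abs_mul, abs_of_pos hτ, mul_left_comm, mul_assoc τ]
  gcongr
  rw [abs_le] at hprod hS hA hB ⊢
  constructor <;> linarith

lemma abs_matchingErrorDeriv₂_le {τ x : ℝ} (hτ : 0 < τ) (hτ1 : 1 ≤ |Real.log τ|)
    (hτ2 : τ ≤ 1 / 4) (hτx : τ < x) (hx1 : x < 1) (hx : τ ≤ x ^ 2) :
    |matchingErrorDeriv₂ τ x| ≤ 100 * (τ * |Real.log τ|) := by
  have hx0 : 0 < x := hτ.trans hτx
  have hD := abs_log_two_mul_tan_half_sub_log_le hτ hτ1 (by linarith) hτx hx1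
  obtain ⟨hs1, hs2, hs3⟩ := sqrt_sq_sub_sq_bounds hτ hτ2 hx0 hx
  obtain ⟨hsin1, hsin2, hsin3⟩ := sin_bounds hx0 hx1
  rw [matchingErrorDeriv₂]
  set s := Real.sqrt (x ^ 2 - τ ^ 2)
  set T := Real.log (2 * Real.tan (x / 2))
  have hspos : 0 < s := by linarith
  have hsinpos : 0 < Real.sin x := by linarith
  have hA : |x / s ^ 3 - 1 / x ^ 2| ≤ 24 := by
    have h1 : (x / 2) ^ 3 ≤ s ^ 3 := by gcongr
    have h2 : s ^ 3 ≤ x ^ 3 := by gcongr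
    have h3 : x ^ 3 - s ^ 3 ≤ x ^ 3 * (3 * x ^ 2) := by
      have : x ^ 2 + x * s + s ^ 2 ≤ 3 * x ^ 2 := by nlinarith
      calc x ^ 3 - s ^ 3 = (x - s) * (x ^ 2 + x * s + s ^ 2) := by ring
        _ ≤ x ^ 3 * (3 * x ^ 2) := by gcongr
    have h4 := mul_le_mul_of_nonneg_left h1 (sq_nonneg x)
    rw [div_sub_div _ _ (by positivity) (by positivity), abs_div,
      abs_of_pos (show 0 < s ^ 3 * x ^ 2 by positivity), div_le_iff₀ (by positivity),
      abs_of_nonneg (by linarith)]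
    linarith
  have hB : |1 / Real.sin x ^ 2 - 1 / x ^ 2| ≤ 2 := by
    have h1 : (x / 2) ^ 2 ≤ Real.sin x ^ 2 := by gcongr
    have h2 : Real.sin x ^ 2 ≤ x ^ 2 := by gcongr
    have h3 : x ^ 2 - Real.sin x ^ 2 ≤ x ^ 3 / 6 * (2 * x) := by
      calc x ^ 2 - Real.sin x ^ 2 = (x - Real.sin x) * (x + Real.sin x) := by ring
        _ ≤ x ^ 3 / 6 * (2 * x) := by
          gcongr
          linarith
    have h4 := mul_le_mul_of_nonneg_left h1 (sq_nonneg x)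
    have h5 := pow_pos hx0 4
    rw [div_sub_div _ _ (by positivity) (by positivity), abs_div,
      abs_of_pos (show 0 < Real.sin x ^ 2 * x ^ 2 by positivity), div_le_iff₀ (by positivity),
      abs_of_nonneg (by linarith)]
    linarith
  have hC := Real.abs_cos_le_one x
  have hprod : |Real.cos x * (T - Real.log (τ / 2))| ≤ 1 * (3 * |Real.log τ|) := by
    rw [abs_mul]
    gcongr
  have heq : τ * (-x / s ^ 3) - τ * (-Real.cos x * T - 1 - 1 / Real.sin x ^ 2 + Real.cos x) -
      τ * Real.log (τ / 2) * Real.cos x =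
      τ * (Real.cos x * (T - Real.log (τ / 2)) + 1 - Real.cos x - (x / s ^ 3 - 1 / x ^ 2) +
        (1 / Real.sin x ^ 2 - 1 / x ^ 2)) := by
    ring
  rw [heq, abs_mul, abs_of_pos hτ, mul_left_comm]
  gcongr
  rw [abs_le] at hprod hC hA hB ⊢
  constructor <;> linarith


/-- Matching of the catenoid profile to the singular linearized Willmore solution
(Lemma 5.1(iii)): with `α = 1/10`, `φ_cat(r) = τ·log(r/τ + √((r/τ)² − 1))`,
`G(r) = cos r · log(2·tan(r/2)) + 1 − cos r`, and
`f_τ(r) = φ_cat(r) − τ·G(r) + τ·log(τ/2)·cos r`, there exist `C > 0` and `τ₀ > 0` such that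
for all `τ ∈ (0, τ₀)`, all `r ∈ (τ^α, 9·τ^α)` and each `k ∈ {0, 1, 2}`,
`|f_τ^{(k)}(r)| ≤ C·τ^{1+(2−k)·α}·|log τ|`. -/
theorem catenoid_green_matching_estimate :
    ∃ C : ℝ, 0 < C ∧ ∃ τ₀ : ℝ, 0 < τ₀ ∧
      ∀ τ : ℝ, 0 < τ → τ < τ₀ →
        ∀ r : ℝ, τ ^ ((1 : ℝ) / 10) < r → r < 9 * τ ^ ((1 : ℝ) / 10) →
          ∀ k : ℕ, k ≤ 2 →
            |iteratedDeriv k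
                (fun x : ℝ =>
                  τ * Real.log (x / τ + Real.sqrt ((x / τ) ^ 2 - 1)) -
                    τ * (Real.cos x * Real.log (2 * Real.tan (x / 2)) + 1 - Real.cos x) +
                    τ * Real.log (τ / 2) * Real.cos x) r| ≤
              C * τ ^ (1 + ((2 : ℝ) - (k : ℝ)) * ((1 : ℝ) / 10)) * |Real.log τ| := by
  refine ⟨8100, by norm_num, (1 / 10) ^ 10, by norm_num, ?_⟩
  intro τ hτ hτ₀ r hr hr' k hk
  set a : ℝ := τ ^ ((1 : ℝ) / 10) with ha
  have ha0 : 0 < a := Real.rpow_pos_of_pos hτ _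
  have hapow : a ^ 10 = τ := by
    rw [ha, ← Real.rpow_natCast, ← Real.rpow_mul hτ.le]
    norm_num
  have ha1 : a < 1 / 10 := lt_of_pow_lt_pow_left₀ 10 (by norm_num) (by rwa [hapow])
  have hτa : τ ≤ a ^ 2 := hapow ▸ pow_le_pow_of_le_one ha0.le (by linarith) (by norm_num)
  have hr0 : 0 < r := ha0.trans hr
  have hr1 : r < 1 := by linarith
  have hτr : τ < r := by nlinarith
  have hτr2 : τ ≤ r ^ 2 := hτa.trans (by gcongr)
  have hrpi : r < Real.pi := by linarith [Real.pi_gt_three]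
  have hτ2 : τ ≤ 1 / 4 := by
    norm_num at hτ₀
    linarith
  have hτ1 : 1 ≤ |Real.log τ| := by
    have h := Real.log_le_log hτ hτ2
    have h4 : Real.log (1 / 4) = -(2 * Real.log 2) := by
      rw [one_div, Real.log_inv, show (4 : ℝ) = 2 ^ 2 by norm_num, Real.log_pow]
      norm_num
    have := Real.log_two_gt_d9
    linarith [neg_le_abs (Real.log τ)]
  have hpow (m : ℕ) : τ ^ (1 + (m : ℝ) * ((1 : ℝ) / 10)) = τ * a ^ m := by
    rw [Real.rpow_add hτ, Real.rpow_one, mul_comm (m : ℝ), Real.rpow_mul hτ.le,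
      Real.rpow_natCast]
  have hderiv : deriv (fun x : ℝ =>
      τ * Real.log (x / τ + Real.sqrt ((x / τ) ^ 2 - 1)) -
        τ * (Real.cos x * Real.log (2 * Real.tan (x / 2)) + 1 - Real.cos x) +
        τ * Real.log (τ / 2) * Real.cos x) =ᶠ[nhds r] matchingErrorDeriv τ := by
    filter_upwards [Ioo_mem_nhds hτr hrpi] with x hx
    exact (hasDerivAt_matchingError hτ hx.1 hx.2).deriv
  interval_cases k
  · have h2 : (2 : ℝ) - ((0 : ℕ) : ℝ) = (2 : ℕ) := by norm_num
    rw [iteratedDeriv_zero, h2, hpow]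
    refine (abs_matchingError_le hτ hτ1 hτ2 hτr hr1 hτr2).trans ?_
    have : r ^ 2 ≤ (9 * a) ^ 2 := by gcongr
    calc 100 * (τ * r ^ 2 * |Real.log τ|) ≤ 100 * (τ * (9 * a) ^ 2 * |Real.log τ|) := by gcongr
      _ = 8100 * (τ * a ^ 2) * |Real.log τ| := by ring
  · have h1 : (2 : ℝ) - ((1 : ℕ) : ℝ) = (1 : ℕ) := by norm_num
    rw [iteratedDeriv_one, h1, hpow, hderiv.eq_of_nhds]
    refine (abs_matchingErrorDeriv_le hτ hτ1 hτ2 hτr hr1 hτr2).trans ?_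
    calc 100 * (τ * r * |Real.log τ|) ≤ 100 * (τ * (81 * a) * |Real.log τ|) := by
          gcongr
          linarith
      _ = 8100 * (τ * a ^ 1) * |Real.log τ| := by ring
  · have h0 : (2 : ℝ) - ((2 : ℕ) : ℝ) = (0 : ℕ) := by norm_num
    rw [iteratedDeriv_succ, iteratedDeriv_one, h0, hpow, hderiv.deriv_eq,
      (hasDerivAt_matchingErrorDeriv hτ hτr hrpi).deriv]
    refine (abs_matchingErrorDeriv₂_le hτ hτ1 hτ2 hτr hr1 hτr2).trans ?_
    have : 0 ≤ τ * |Real.log τ| := by positivity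
    linarith
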